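/- arXiv:1209.0523 — 7 statements merged into one kernel-verified Lean document; each statement's English description precedes it below -/
import Mathlib

section
/- Let n, p, q be natural numbers with p ≤ n. Let X ∈ ℂ^{n×p} and X⊥ ∈ ℂ^{n×(n−p)} be such that the block matrix [X X⊥] is unitary, and let Y ∈ ℂ^{n×q} satisfy YᴴY = I. Let B ∈ ℂ^{q×p} be the Moore–Penrose pseudoinverse of XᴴY, and set T = X⊥ᴴ Y B ∈ ℂ^{(n−p)×p}. Then for every real number t > 0, the dimension of the kernel of TᴴT − t²·I (as a linear map on ℂ^p) equals the dimension of the kernel of (XᴴY)ᴴ(XᴴY) − (1+t²)⁻¹·I (as a linear map on ℂ^q). In other words, the positive singular values of T are exactly the tangents of the principal angles in (0, π/2) between the column spaces of X and Y, counted with multiplicity. -/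
open scoped Matrix

/-- `B` is the Moore–Penrose pseudoinverse of `A`. -/
def IsMoorePenrose {m n : ℕ} (A : Matrix (Fin m) (Fin n) ℂ)
    (B : Matrix (Fin n) (Fin m) ℂ) : Prop :=
  A * B * A = A ∧ B * A * B = B ∧ (A * B)ᴴ = A * B ∧ (B * A)ᴴ = B * A

theorem finrank_ker_eq_aux {p q : ℕ} (M : Matrix (Fin p) (Fin p) ℂ) (N : Matrix (Fin q) (Fin q) ℂ)
    (B : Matrix (Fin q) (Fin p) ℂ) (C : Matrix (Fin p) (Fin q) ℂ)
    (h1 : ∀ v, M *ᵥ v = 0 → N *ᵥ (B *ᵥ v) = 0 ∧ C *ᵥ (B *ᵥ v) = v)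
    (h2 : ∀ w, N *ᵥ w = 0 → M *ᵥ (C *ᵥ w) = 0 ∧ B *ᵥ (C *ᵥ w) = w) :
    Module.finrank ℂ (LinearMap.ker M.mulVecLin) = Module.finrank ℂ (LinearMap.ker N.mulVecLin) := by
  have a1 : ∀ v ∈ LinearMap.ker M.mulVecLin, B.mulVecLin v ∈ LinearMap.ker N.mulVecLin := by
    intro v hv
    exact (h1 v hv).1
  have a2 : ∀ v ∈ LinearMap.ker N.mulVecLin, C.mulVecLin v ∈ LinearMap.ker M.mulVecLin := by
    intro v hv
    exact (h2 v hv).1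
  refine LinearEquiv.finrank_eq (LinearEquiv.ofLinearMap (B.mulVecLin.restrict a1)
    (C.mulVecLin.restrict a2) ?_ ?_)
  · refine LinearMap.ext fun w => Subtype.ext ?_
    exact (h2 w.1 w.2).2
  · refine LinearMap.ext fun w => Subtype.ext ?_
    exact (h1 w.1 w.2).2

theorem tan_theta_basis
    (n p q : ℕ) (hpn : p ≤ n)
    (X : Matrix (Fin n) (Fin p) ℂ) (Xp : Matrix (Fin n) (Fin (n - p)) ℂ)
    (hX : Xᴴ * X = 1) (hXp : Xpᴴ * Xp = 1) (hXXp : Xᴴ * Xp = 0)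
    (hunit : X * Xᴴ + Xp * Xpᴴ = 1)
    (Y : Matrix (Fin n) (Fin q) ℂ) (hY : Yᴴ * Y = 1)
    (B : Matrix (Fin q) (Fin p) ℂ) (hB : IsMoorePenrose (Xᴴ * Y) B)
    (T : Matrix (Fin (n - p)) (Fin p) ℂ) (hT : T = Xpᴴ * Y * B) :
    ∀ t : ℝ, 0 < t →
      Module.finrank ℂ (LinearMap.ker (Tᴴ * T - ((t : ℂ) ^ 2) • 1).mulVecLin)
        = Module.finrank ℂ
            (LinearMap.ker ((Xᴴ * Y)ᴴ * (Xᴴ * Y) - (1 + (t : ℂ) ^ 2)⁻¹ • 1).mulVecLin) := by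
  intro t ht
  obtain ⟨b1, b2, b3, b4⟩ := hB
  have e1 : Tᴴ * T = Bᴴ * B - (Xᴴ * Y) * B := by
    have hq : Xp * Xpᴴ = 1 - X * Xᴴ := by rw [← hunit]; abel
    have : Tᴴ * T = Bᴴ * (Yᴴ * (Xp * Xpᴴ) * Y) * B := by
      rw [hT]; simp only [Matrix.conjTranspose_mul, Matrix.conjTranspose_conjTranspose,
        Matrix.mul_assoc]
    have h2 : Yᴴ * (X * Xᴴ) * Y = (Xᴴ * Y)ᴴ * (Xᴴ * Y) := by
      simp only [Matrix.conjTranspose_mul, Matrix.conjTranspose_conjTranspose, Matrix.mul_assoc]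
    rw [this, hq, Matrix.mul_sub, Matrix.sub_mul, Matrix.mul_one, hY, h2, Matrix.mul_sub,
      Matrix.sub_mul, Matrix.mul_one]
    congr 1
    calc Bᴴ * ((Xᴴ * Y)ᴴ * (Xᴴ * Y)) * B = ((Xᴴ * Y) * B)ᴴ * ((Xᴴ * Y) * B) := by
          rw [Matrix.conjTranspose_mul (Xᴴ * Y) B]; simp only [Matrix.mul_assoc]
      _ = (Xᴴ * Y) * B := by rw [b3, ← Matrix.mul_assoc, b1]
  generalize Xᴴ * Y = C at *
  have e3 : Cᴴ * (C * B) = Cᴴ := by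
    rw [← b3, ← Matrix.conjTranspose_mul, b1]
  have e4 : Cᴴ * (Bᴴ * B) = B := by
    rw [← Matrix.mul_assoc, ← Matrix.conjTranspose_mul, b4, b2]
  have e5 : B * C * Cᴴ = Cᴴ := by
    rw [← b4, ← Matrix.conjTranspose_mul, ← Matrix.mul_assoc, b1]
  have e6 : Bᴴ * (Cᴴ * C) = C := by
    rw [← Matrix.mul_assoc, ← Matrix.conjTranspose_mul, b3, b1]
  have e7 : C * B * Bᴴ = Bᴴ := by
    rw [← b3, ← Matrix.conjTranspose_mul, ← Matrix.mul_assoc, b2]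
  have e2 : C * B * (Tᴴ * T) = Tᴴ * T := by
    rw [e1, Matrix.mul_sub, ← Matrix.mul_assoc, e7, ← Matrix.mul_assoc, b1]
  have ht2 : (t : ℂ) ^ 2 ≠ 0 := pow_ne_zero 2 (by exact_mod_cast ht.ne')
  have hs : (1 + (t : ℂ) ^ 2) ≠ 0 := by
    have : (1 + t ^ 2 : ℝ) ≠ 0 := by positivity
    exact_mod_cast this
  apply finrank_ker_eq_aux _ _ B C
  · intro v hv
    rw [Matrix.sub_mulVec, Matrix.smul_mulVec, Matrix.one_mulVec, sub_eq_zero] at hv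
    have hP : (C * B) *ᵥ v = v := by
      have h := congrArg (fun u => (C * B) *ᵥ u) hv
      simp only [Matrix.mulVec_mulVec, e2, Matrix.mulVec_smul] at h
      rw [hv] at h
      exact (smul_right_injective _ ht2 h).symm
    have hBB : (Bᴴ * B) *ᵥ v = (1 + (t : ℂ) ^ 2) • v := by
      rw [e1, Matrix.sub_mulVec, hP, sub_eq_iff_eq_add] at hv
      rw [hv, add_smul, one_smul, add_comm]
    refine ⟨?_, by rw [Matrix.mulVec_mulVec, hP]⟩
    rw [Matrix.sub_mulVec, Matrix.smul_mulVec, Matrix.one_mulVec, sub_eq_zero,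
      Matrix.mulVec_mulVec, Matrix.mul_assoc, e3]
    have h := congrArg (fun u => Cᴴ *ᵥ u) hBB
    simp only [Matrix.mulVec_mulVec, e4, Matrix.mulVec_smul] at h
    rw [h, smul_smul, inv_mul_cancel₀ hs, one_smul]
  · intro w hw
    rw [Matrix.sub_mulVec, Matrix.smul_mulVec, Matrix.one_mulVec, sub_eq_zero] at hw
    have hw' : w = (1 + (t : ℂ) ^ 2) • ((Cᴴ * C) *ᵥ w) := by
      rw [hw, smul_smul, mul_inv_cancel₀ hs, one_smul]
    have hBC : (B * C) *ᵥ w = w := by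
      have h := congrArg (fun u => (B * C) *ᵥ u) hw'
      simp only [Matrix.mulVec_smul, Matrix.mulVec_mulVec] at h
      rw [← Matrix.mul_assoc, e5, ← hw'] at h
      exact h
    refine ⟨?_, by rw [Matrix.mulVec_mulVec, hBC]⟩
    have h := congrArg (fun u => Bᴴ *ᵥ u) hw'
    simp only [Matrix.mulVec_smul, Matrix.mulVec_mulVec, e6] at h
    rw [Matrix.sub_mulVec, Matrix.smul_mulVec, Matrix.one_mulVec, e1, Matrix.sub_mulVec,
      Matrix.mulVec_mulVec, Matrix.mulVec_mulVec, b1, Matrix.mul_assoc, ← Matrix.mulVec_mulVec,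
      hBC, h, add_smul, one_smul]
    abel
end

section
/- Let [X X⊥] ∈ ℂ^{n×n} be unitary with X ∈ ℂ^{n×p}, let Y ∈ ℂ^{n×q} satisfy YᴴY = I, let B be the Moore–Penrose pseudoinverse of XᴴY, and set T = X⊥ᴴ Y B. Then rank(T) = rank(XᴴY) − dim(ran(X) ⊓ ran(Y)), where ran(X) and ran(Y) denote the column spaces of X and Y as subspaces of ℂ^n. (This expresses that the list of tangents of the nonzero, non-π/2 principal angles, i.e. the positive singular values of T, is followed by exactly dim(ran(X) ∩ ran(Y)) zeros.) -/
open scoped Matrix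

theorem rank_T_eq_rank_sub_dim_inter
    (n p q : ℕ)
    (X : Matrix (Fin n) (Fin p) ℂ) (Xp : Matrix (Fin n) (Fin (n - p)) ℂ)
    (hX : Xᴴ * X = 1) (hXp : Xpᴴ * Xp = 1) (hXXp : Xᴴ * Xp = 0)
    (hunit : X * Xᴴ + Xp * Xpᴴ = 1)
    (Y : Matrix (Fin n) (Fin q) ℂ) (hY : Yᴴ * Y = 1)
    (B : Matrix (Fin q) (Fin p) ℂ) (hB : IsMoorePenrose (Xᴴ * Y) B)
    (T : Matrix (Fin (n - p)) (Fin p) ℂ) (hT : T = Xpᴴ * Y * B) :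
    T.rank = (Xᴴ * Y).rank -
      Module.finrank ℂ
        ↥(LinearMap.range X.mulVecLin ⊓ LinearMap.range Y.mulVecLin) := by
  obtain ⟨h1, h2, h3, h4⟩ := hB
  have hBr : B.rank = (Xᴴ * Y).rank := by
    apply le_antisymm
    · rw [← h2]
      exact (Matrix.rank_mul_le_left _ _).trans (Matrix.rank_mul_le_right _ _)
    · conv_lhs => rw [← h1]
      exact (Matrix.rank_mul_le_left _ _).trans (Matrix.rank_mul_le_right _ _)
  have hBA : B * (Xᴴ * Y) * (Xᴴ * Y)ᴴ = (Xᴴ * Y)ᴴ := by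
    rw [← h4, ← Matrix.conjTranspose_mul, ← Matrix.mul_assoc, h1]
  -- key identity on vectors killed by `Xpᴴ * Y`
  have hkey : ∀ v : Fin q → ℂ, (Xpᴴ * Y) *ᵥ v = 0 → X *ᵥ ((Xᴴ * Y) *ᵥ v) = Y *ᵥ v := by
    intro v hv
    have e : X * (Xᴴ * Y) + Xp * (Xpᴴ * Y) = Y := by
      rw [← Matrix.mul_assoc, ← Matrix.mul_assoc, ← Matrix.add_mul, hunit, Matrix.one_mul]
    have e2 := congrArg (fun M => M *ᵥ v) e
    simp only [Matrix.add_mulVec] at e2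
    rw [← Matrix.mulVec_mulVec, ← Matrix.mulVec_mulVec (M := Xp), hv, Matrix.mulVec_zero,
      add_zero] at e2
    exact e2
  have hYinj : Function.Injective Y.mulVecLin := by
    intro a b hab
    have e := congrArg (fun w => Yᴴ *ᵥ w) hab
    simpa [Matrix.mulVecLin_apply, Matrix.mulVec_mulVec, hY] using e
  have hkB : ∀ v : Fin q → ℂ, (Xpᴴ * Y) *ᵥ v = 0 → v ∈ LinearMap.range B.mulVecLin := by
    intro v hv
    have e := hkey v hv
    have e1 : v = (Xᴴ * Y)ᴴ *ᵥ ((Xᴴ * Y) *ᵥ v) := by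
      have e2 := congrArg (fun w => Yᴴ *ᵥ w) e
      simp only [Matrix.mulVec_mulVec, hY, Matrix.one_mulVec] at e2
      rw [Matrix.mulVec_mulVec, Matrix.conjTranspose_mul, Matrix.conjTranspose_conjTranspose,
        Matrix.mul_assoc]
      exact e2.symm
    rw [← hBA] at e1
    refine ⟨(Xᴴ * Y) *ᵥ ((Xᴴ * Y)ᴴ *ᵥ ((Xᴴ * Y) *ᵥ v)), ?_⟩
    rw [Matrix.mulVecLin_apply]
    conv_rhs => rw [e1]
    simp only [Matrix.mulVec_mulVec, Matrix.mul_assoc]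
  set P := LinearMap.range B.mulVecLin with hP
  have hrn := LinearMap.finrank_range_add_finrank_ker ((Xpᴴ * Y).mulVecLin.domRestrict P)
  have hr : T.rank = Module.finrank ℂ (LinearMap.range ((Xpᴴ * Y).mulVecLin.domRestrict P)) := by
    rw [LinearMap.range_domRestrict, hP, ← LinearMap.range_comp, ← Matrix.mulVecLin_mul, ← hT]
    rfl
  have hinj : Function.Injective (Y.mulVecLin ∘ₗ P.subtype) :=
    hYinj.comp P.injective_subtype
  have hmap : (LinearMap.ker ((Xpᴴ * Y).mulVecLin.domRestrict P)).map (Y.mulVecLin ∘ₗ P.subtype)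
      = LinearMap.range X.mulVecLin ⊓ LinearMap.range Y.mulVecLin := by
    ext w
    constructor
    · rintro ⟨⟨v, hvP⟩, hv, rfl⟩
      have hv' : (Xpᴴ * Y) *ᵥ v = 0 := hv
      exact ⟨⟨_, hkey v hv'⟩, ⟨v, rfl⟩⟩
    · rintro ⟨⟨u, hu⟩, ⟨v, rfl⟩⟩
      have hv : (Xpᴴ * Y) *ᵥ v = 0 := by
        have hz : Xpᴴ * X = 0 := by
          have := congrArg Matrix.conjTranspose hXXp
          simpa [Matrix.conjTranspose_mul] using this
        have hu' : X *ᵥ u = Y *ᵥ v := hu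
        rw [← Matrix.mulVec_mulVec, ← hu', Matrix.mulVec_mulVec, hz, Matrix.zero_mulVec]
      exact ⟨⟨v, hkB v hv⟩, hv, rfl⟩
  have hk := (Submodule.equivMapOfInjective _ hinj
    (LinearMap.ker ((Xpᴴ * Y).mulVecLin.domRestrict P))).finrank_eq
  rw [hmap] at hk
  have hPr : Module.finrank ℂ P = (Xᴴ * Y).rank := hBr
  omega
end

section
/- Let [X X⊥] ∈ ℂ^{n×n} be unitary with X ∈ ℂ^{n×p}, let Y ∈ ℂ^{n×q} satisfy YᴴY = I, let W = XᴴY, let B be the Moore–Penrose pseudoinverse of W, and set T = X⊥ᴴ Y B. Then TᴴT = BᴴB − W B. (Equivalently, TᴴT = (WWᴴ)† − WW†, which encodes the identity tan²θ = 1/cos²θ − 1 for the principal angles between the column spaces of X and Y.) -/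
open scoped Matrix

theorem T_conjTranspose_mul_T
    (n p q : ℕ)
    (X : Matrix (Fin n) (Fin p) ℂ) (Xp : Matrix (Fin n) (Fin (n - p)) ℂ)
    (hX : Xᴴ * X = 1) (hXp : Xpᴴ * Xp = 1) (hXXp : Xᴴ * Xp = 0)
    (hunit : X * Xᴴ + Xp * Xpᴴ = 1)
    (Y : Matrix (Fin n) (Fin q) ℂ) (hY : Yᴴ * Y = 1)
    (W : Matrix (Fin p) (Fin q) ℂ) (hW : W = Xᴴ * Y)
    (B : Matrix (Fin q) (Fin p) ℂ) (hB : IsMoorePenrose W B)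
    (T : Matrix (Fin (n - p)) (Fin p) ℂ) (hT : T = Xpᴴ * Y * B) :
    Tᴴ * T = Bᴴ * B - W * B := by
  obtain ⟨h1, h2, h3, h4⟩ := hB
  have hP : Xp * Xpᴴ = 1 - X * Xᴴ := eq_sub_of_add_eq' hunit
  have e1 : Tᴴ * T = Bᴴ * (Yᴴ * (Xp * Xpᴴ) * Y) * B := by
    rw [hT]
    simp only [Matrix.conjTranspose_mul, Matrix.conjTranspose_conjTranspose, Matrix.mul_assoc]
  have e2 : Yᴴ * (Xp * Xpᴴ) * Y = 1 - Wᴴ * W := by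
    rw [hP, Matrix.mul_sub, Matrix.sub_mul, Matrix.mul_one, hY, hW]
    simp only [Matrix.conjTranspose_mul, Matrix.conjTranspose_conjTranspose, Matrix.mul_assoc]
  have e3 : Bᴴ * (Wᴴ * W) * B = W * B := by
    calc Bᴴ * (Wᴴ * W) * B = (W * B)ᴴ * (W * B) := by
          simp only [Matrix.conjTranspose_mul, Matrix.mul_assoc]
      _ = W * B * W * B := by rw [h3, ← Matrix.mul_assoc]
      _ = W * B := by rw [h1]
  rw [e1, e2, Matrix.mul_sub, Matrix.sub_mul, Matrix.mul_one, e3]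
end

section
/- Let X ∈ ℂ^{n×p} and Y ∈ ℂ^{n×q}, and suppose Y = U Σ Vᴴ where U ∈ ℂ^{n×t} has orthonormal columns (UᴴU = I), V ∈ ℂ^{q×t} has orthonormal columns (VᴴV = I), and Σ ∈ ℂ^{t×t} is invertible (a reduced singular value decomposition of Y of rank t). Assume rank(XᴴY) = t. If B₁ is the Moore–Penrose pseudoinverse of XᴴY and B₂ is the Moore–Penrose pseudoinverse of XᴴU, then Y B₁ = U B₂. In particular, for any matrix X⊥, X⊥ᴴ Y (XᴴY)† = X⊥ᴴ U (XᴴU)†. -/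
open scoped Matrix

theorem reduced_svd_replacement
    (n p q t : ℕ)
    (X : Matrix (Fin n) (Fin p) ℂ) (Y : Matrix (Fin n) (Fin q) ℂ)
    (U : Matrix (Fin n) (Fin t) ℂ) (hU : Uᴴ * U = 1)
    (V : Matrix (Fin q) (Fin t) ℂ) (hV : Vᴴ * V = 1)
    (S : Matrix (Fin t) (Fin t) ℂ) (hS : IsUnit S)
    (hY : Y = U * S * Vᴴ)
    (hrank : (Xᴴ * Y).rank = t)
    (B₁ : Matrix (Fin q) (Fin p) ℂ) (hB₁ : IsMoorePenrose (Xᴴ * Y) B₁)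
    (B₂ : Matrix (Fin t) (Fin p) ℂ) (hB₂ : IsMoorePenrose (Xᴴ * U) B₂) :
    Y * B₁ = U * B₂ ∧
      ∀ (m : ℕ) (Xp : Matrix (Fin n) (Fin m) ℂ),
        Xpᴴ * Y * B₁ = Xpᴴ * U * B₂ := by
  obtain ⟨h1, -, h3, -⟩ := hB₁
  obtain ⟨k1, -, k3, -⟩ := hB₂
  have hdet : IsUnit S.det := (Matrix.isUnit_iff_isUnit_det S).1 hS
  set A := Xᴴ * U with hA
  have hXY : Xᴴ * Y = A * (S * Vᴴ) := by
    rw [hY, hA]; simp only [Matrix.mul_assoc]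
  have hMN : (S * Vᴴ) * (V * S⁻¹) = 1 := by
    calc (S * Vᴴ) * (V * S⁻¹) = S * (Vᴴ * V) * S⁻¹ := by simp only [Matrix.mul_assoc]
      _ = 1 := by rw [hV, Matrix.mul_one, Matrix.mul_nonsing_inv _ hdet]
  rw [hXY] at h1 h3 hrank
  have hr : A.rank = t := by
    apply le_antisymm
    · simpa using A.rank_le_width
    · calc t = (A * (S * Vᴴ)).rank := hrank.symm
        _ ≤ A.rank := Matrix.rank_mul_le_left _ _
  have hG : IsUnit (Aᴴ * A) := by
    rw [← Matrix.linearIndependent_cols_iff_isUnit, linearIndependent_iff_card_eq_finrank_span]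
    have hs : (Aᴴ * A).rank = A.rank := by
      open scoped ComplexOrder in exact Matrix.rank_conjTranspose_mul_self A
    rw [← hs, Matrix.rank_eq_finrank_span_cols] at hr
    simpa [Set.finrank] using hr.symm
  have hGd := (Matrix.isUnit_iff_isUnit_det _).1 hG
  set C := (S * Vᴴ) * B₁ with hC
  have hACA : A * C * A = A := by
    have := congrArg (fun Z => Z * (V * S⁻¹)) h1
    calc A * C * A = A * C * A * ((S * Vᴴ) * (V * S⁻¹)) := by rw [hMN, Matrix.mul_one]
      _ = A * (S * Vᴴ) * B₁ * (A * (S * Vᴴ)) * (V * S⁻¹) := by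
        rw [hC]; simp only [Matrix.mul_assoc]
      _ = A * (S * Vᴴ) * (V * S⁻¹) := this
      _ = A := by rw [Matrix.mul_assoc A, hMN, Matrix.mul_one]
  have hACh : (A * C)ᴴ = A * C := by
    rw [hC, ← Matrix.mul_assoc]; exact h3
  have hAC : A * C = A * B₂ := by
    calc A * C = (A * C)ᴴ := hACh.symm
      _ = ((A * B₂) * (A * C))ᴴ := by rw [← Matrix.mul_assoc (A * B₂) A C, k1]
      _ = (A * C) * (A * B₂) := by rw [Matrix.conjTranspose_mul (A * B₂), hACh, k3]
      _ = A * B₂ := by rw [← Matrix.mul_assoc (A * C), hACA]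
  have hCB : C = B₂ := by
    have h := congrArg (fun Z => (Aᴴ * A)⁻¹ * (Aᴴ * Z)) hAC
    simp only [← Matrix.mul_assoc Aᴴ] at h
    rwa [Matrix.nonsing_inv_mul_cancel_left _ _ hGd,
      Matrix.nonsing_inv_mul_cancel_left _ _ hGd] at h
  have main : Y * B₁ = U * B₂ := by
    rw [← hCB, hC, hY]; simp only [Matrix.mul_assoc]
  refine ⟨main, fun m Xp => ?_⟩
  rw [Matrix.mul_assoc, main, Matrix.mul_assoc]
end

section
/- Let [Q Q⊥] ∈ ℂ^{n×n} be unitary with Q ∈ ℂ^{n×p}. Let X ∈ ℂ^{n×p} and Y ∈ ℂ^{n×q} with q ≤ p, and suppose X = Q R₁₁ with R₁₁ ∈ ℂ^{p×p} invertible, and Y = Q R₁₂ + Q⊥ R₂₂ (so that [X Y] = [Q Q⊥]·[[R₁₁, R₁₂],[0, R₂₂]] is a QR factorization). Then: (a) R₁₂ = QᴴY and R₂₂ = Q⊥ᴴY; (b) rank(QᴴY) = rank(XᴴY); and (c) if B denotes the Moore–Penrose pseudoinverse of R₁₂, then R₂₂ B = Q⊥ᴴ Y (QᴴY)†, so that,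 when rank(Y) = rank(XᴴY) = q, for every real t > 0 the dimension of the kernel of (R₂₂B)ᴴ(R₂₂B) − t²·I equals the dimension of the kernel of (QᴴY₀)ᴴ(QᴴY₀) − (1+t²)⁻¹·I for any matrix Y₀ with orthonormal columns whose column space equals that of Y. -/
open scoped Matrix

/-- The Moore–Penrose pseudoinverse is unique. -/
theorem mp_unique {m n : ℕ} {A : Matrix (Fin m) (Fin n) ℂ} {B C : Matrix (Fin n) (Fin m) ℂ}
    (hB : IsMoorePenrose A B) (hC : IsMoorePenrose A C) : B = C := by
  obtain ⟨b1, b2, b3, b4⟩ := hB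
  obtain ⟨c1, c2, c3, c4⟩ := hC
  have h1 : A * B = A * C := by
    calc A * B = (A * C * A) * B := by rw [c1]
      _ = (A * C)ᴴ * (A * B)ᴴ := by rw [b3, c3]; simp only [Matrix.mul_assoc]
      _ = ((A * B * A) * C)ᴴ := by
        rw [← Matrix.conjTranspose_mul]; simp only [Matrix.mul_assoc]
      _ = A * C := by rw [b1, c3]
  have h2 : B * A = C * A := by
    calc B * A = B * (A * C * A) := by rw [c1]
      _ = (B * A)ᴴ * (C * A)ᴴ := by rw [b4, c4]; simp only [Matrix.mul_assoc]
      _ = (C * (A * B * A))ᴴ := by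
        rw [← Matrix.conjTranspose_mul]; simp only [Matrix.mul_assoc]
      _ = C * A := by rw [b1, c4]
  calc B = B * A * B := b2.symm
    _ = C * (A * B) := by rw [h2, Matrix.mul_assoc]
    _ = C := by rw [h1, ← Matrix.mul_assoc, c2]

theorem ker_le {p q : ℕ} {M : Matrix (Fin p) (Fin p) ℂ} {N : Matrix (Fin q) (Fin q) ℂ}
    (F : Matrix (Fin q) (Fin p) ℂ) (K : Matrix (Fin q) (Fin p) ℂ) (h : N * F = K * M)
    (hi : ∀ v, M *ᵥ v = 0 → F *ᵥ v = 0 → v = 0) :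
    Module.finrank ℂ (LinearMap.ker M.mulVecLin) ≤
      Module.finrank ℂ (LinearMap.ker N.mulVecLin) := by
  have hm : ∀ v ∈ LinearMap.ker M.mulVecLin, F.mulVecLin v ∈ LinearMap.ker N.mulVecLin := by
    intro v hv
    simp only [LinearMap.mem_ker, Matrix.mulVecLin_apply] at hv ⊢
    rw [Matrix.mulVec_mulVec, h, ← Matrix.mulVec_mulVec, hv, Matrix.mulVec_zero]
  apply LinearMap.finrank_le_finrank_of_injective (f := F.mulVecLin.restrict hm)
  rw [← LinearMap.ker_eq_bot, LinearMap.ker_eq_bot']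
  rintro ⟨v, hv⟩ h0
  have h0' := congrArg Subtype.val h0
  apply Subtype.ext
  exact hi v (by simpa using hv) (by simpa using h0')

theorem factor_of_range {n q : ℕ} {Y Z : Matrix (Fin n) (Fin q) ℂ}
    (h : LinearMap.range Z.mulVecLin ≤ LinearMap.range Y.mulVecLin) :
    ∃ T : Matrix (Fin q) (Fin q) ℂ, Z = Y * T := by
  have h1 : ∀ j, ∃ w, Y *ᵥ w = Z.col j := by
    intro j
    have : Z *ᵥ Pi.single j 1 ∈ LinearMap.range Y.mulVecLin := h ⟨_, rfl⟩
    obtain ⟨w, hw⟩ := this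
    exact ⟨w, by simpa using hw⟩
  choose w hw using h1
  refine ⟨Matrix.of fun i j => w j i, ?_⟩
  ext i j
  exact (congrFun (hw j) i).symm

theorem kernel_dims {p q r : ℕ} (A : Matrix (Fin p) (Fin q) ℂ) (D : Matrix (Fin r) (Fin q) ℂ)
    (B : Matrix (Fin q) (Fin p) ℂ) (hB : IsMoorePenrose A B) (hBA : B * A = 1)
    (T S : Matrix (Fin q) (Fin q) ℂ) (hTS : T * S = 1)
    (hN : Tᴴ * (Aᴴ * A + Dᴴ * D) * T = 1) (t : ℝ) (ht : 0 < t) :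
    Module.finrank ℂ (LinearMap.ker ((D * B)ᴴ * (D * B) - ((t : ℂ) ^ 2) • 1).mulVecLin)
      = Module.finrank ℂ
        (LinearMap.ker ((A * T)ᴴ * (A * T) - (1 + (t : ℂ) ^ 2)⁻¹ • 1).mulVecLin) := by
  obtain ⟨b1, b2, b3, b4⟩ := hB
  have hST : S * T = 1 := mul_eq_one_comm.mp hTS
  have hc0 : (1 + (t : ℂ) ^ 2) ≠ 0 := by
    have : (1 + t ^ 2 : ℝ) ≠ 0 := by positivity
    exact_mod_cast this
  have ht0 : ((t : ℂ) ^ 2) ≠ 0 := by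
    have : (t ^ 2 : ℝ) ≠ 0 := by positivity
    exact_mod_cast this
  obtain ⟨c, hc⟩ : ∃ c, c = (1 + (t : ℂ) ^ 2)⁻¹ := ⟨_, rfl⟩
  obtain ⟨s, hs⟩ : ∃ s, s = (t : ℂ) ^ 2 := ⟨_, rfl⟩
  have hcs : 1 - c = c * s := by rw [hc, hs]; field_simp; ring
  obtain ⟨C, hC⟩ : ∃ C, C = Dᴴ * D := ⟨_, rfl⟩
  have hCh : Cᴴ = C := by rw [hC]; simp
  rw [← hC] at hN
  have hM : (D * B)ᴴ * (D * B) = Bᴴ * C * B := by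
    rw [hC, Matrix.conjTranspose_mul]; simp only [Matrix.mul_assoc]
  have hN2 : (A * T)ᴴ * (A * T) = Tᴴ * (Aᴴ * A) * T := by
    rw [Matrix.conjTranspose_mul]; simp only [Matrix.mul_assoc]
  rw [hM, hN2, ← hc, ← hs]
  rw [← hs] at ht0
  have hBA' : Aᴴ * Bᴴ = 1 := by rw [← Matrix.conjTranspose_mul, hBA]; simp
  have hAB : Bᴴ * Aᴴ = A * B := by rw [← Matrix.conjTranspose_mul, b3]
  have hAAB : Aᴴ * A * B = Aᴴ := by
    rw [Matrix.mul_assoc, ← hAB, ← Matrix.mul_assoc, hBA', Matrix.one_mul]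
  have hBAA : Bᴴ * (Aᴴ * A) = A := by
    rw [← Matrix.mul_assoc, hAB, b1]
  have hABB : A * B * Bᴴ = Bᴴ := by
    rw [← hAB, Matrix.mul_assoc, hBA', Matrix.mul_one]
  have hS : S = Tᴴ * (Aᴴ * A + C) := by
    calc S = (Tᴴ * (Aᴴ * A + C) * T) * S := by rw [hN, Matrix.one_mul]
      _ = _ := by rw [Matrix.mul_assoc, hTS, Matrix.mul_one]
  have hSh : Sᴴ = (Aᴴ * A + C) * T := by
    rw [hS]; simp [hCh]
  have hSTh : Sᴴ * Tᴴ = 1 := by rw [← Matrix.conjTranspose_mul, hTS]; simp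
  apply le_antisymm
  · apply ker_le (S * B) (-c • (Tᴴ * Aᴴ))
    · have e1 : Tᴴ * (Aᴴ * A) * T * (S * B) = Tᴴ * Aᴴ := by
        calc _ = Tᴴ * (Aᴴ * A) * (T * S) * B := by simp only [Matrix.mul_assoc]
          _ = Tᴴ * (Aᴴ * A * B) := by rw [hTS]; simp only [Matrix.mul_assoc, Matrix.one_mul]
          _ = _ := by rw [hAAB]
      have e2 : S * B = Tᴴ * Aᴴ + Tᴴ * (C * B) := by
        rw [hS, Matrix.mul_assoc, Matrix.add_mul, hAAB, Matrix.mul_add]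
      have e3 : Tᴴ * Aᴴ * (Bᴴ * C * B) = Tᴴ * (C * B) := by
        calc _ = Tᴴ * (Aᴴ * Bᴴ) * (C * B) := by simp only [Matrix.mul_assoc]
          _ = _ := by rw [hBA', Matrix.mul_one]
      rw [Matrix.sub_mul, e1, Matrix.smul_mul, Matrix.one_mul, e2, Matrix.smul_mul,
        Matrix.mul_sub, e3, Matrix.mul_smul, Matrix.mul_one]
      have hk : c * s = 1 - c := hcs.symm
      rw [smul_sub, smul_smul, neg_mul, hk]
      module
    · intro v hv hF
      rw [Matrix.sub_mulVec, Matrix.smul_mulVec, Matrix.one_mulVec, sub_eq_zero] at hv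
      have hBv : B *ᵥ v = 0 := by
        calc B *ᵥ v = T *ᵥ ((S * B) *ᵥ v) := by
              rw [Matrix.mulVec_mulVec, ← Matrix.mul_assoc, hTS, Matrix.one_mul]
          _ = 0 := by rw [hF, Matrix.mulVec_zero]
      rw [← Matrix.mulVec_mulVec, hBv, Matrix.mulVec_zero] at hv
      exact (smul_eq_zero.mp hv.symm).resolve_left ht0
  · apply ker_le (A * T) (-c⁻¹ • (Bᴴ * Sᴴ))
    · have hcne : c ≠ 0 := by rw [hc]; exact inv_ne_zero hc0
      have e1 : Bᴴ * Sᴴ * (Tᴴ * (Aᴴ * A) * T) = A * T := by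
        calc _ = Bᴴ * (Sᴴ * Tᴴ) * (Aᴴ * A) * T := by simp only [Matrix.mul_assoc]
          _ = _ := by rw [hSTh, Matrix.mul_one, hBAA]
      have e2 : Bᴴ * Sᴴ = A * T + Bᴴ * C * T := by
        rw [hSh, ← Matrix.mul_assoc, Matrix.mul_add, hBAA, Matrix.add_mul]
      have e3 : Bᴴ * C * B * (A * T) = Bᴴ * C * T := by
        calc _ = Bᴴ * C * (B * A) * T := by simp only [Matrix.mul_assoc]
          _ = _ := by rw [hBA, Matrix.mul_one]
      have hcs' : s = c⁻¹ - 1 := by field_simp; linear_combination -hcs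
      rw [Matrix.sub_mul, e3, Matrix.smul_mul, Matrix.one_mul, Matrix.smul_mul,
        Matrix.mul_sub, e1, Matrix.mul_smul, Matrix.mul_one, e2, smul_sub, smul_smul,
        neg_mul, inv_mul_cancel₀ hcne, hcs']
      module
    · intro v _ hF
      calc v = (S * B) *ᵥ ((A * T) *ᵥ v) := by
            rw [Matrix.mulVec_mulVec]
            have : S * B * (A * T) = 1 := by
              calc _ = S * (B * A) * T := by simp only [Matrix.mul_assoc]
                _ = 1 := by rw [hBA, Matrix.mul_one, hST]
            rw [this, Matrix.one_mulVec]
        _ = 0 := by rw [hF, Matrix.mulVec_zero]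

theorem qr_tangent_blocks
    (n p q : ℕ) (hq : q ≤ p)
    (Q : Matrix (Fin n) (Fin p) ℂ) (Qp : Matrix (Fin n) (Fin (n - p)) ℂ)
    (hQ : Qᴴ * Q = 1) (hQp : Qpᴴ * Qp = 1) (hQQp : Qᴴ * Qp = 0)
    (hunit : Q * Qᴴ + Qp * Qpᴴ = 1)
    (X : Matrix (Fin n) (Fin p) ℂ) (Y : Matrix (Fin n) (Fin q) ℂ)
    (R₁₁ : Matrix (Fin p) (Fin p) ℂ) (hR₁₁ : IsUnit R₁₁) (hX : X = Q * R₁₁)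
    (R₁₂ : Matrix (Fin p) (Fin q) ℂ) (R₂₂ : Matrix (Fin (n - p)) (Fin q) ℂ)
    (hY : Y = Q * R₁₂ + Qp * R₂₂)
    (B : Matrix (Fin q) (Fin p) ℂ) (hB : IsMoorePenrose R₁₂ B) :
    R₁₂ = Qᴴ * Y ∧
    R₂₂ = Qpᴴ * Y ∧
    (Qᴴ * Y).rank = (Xᴴ * Y).rank ∧
    (∀ B' : Matrix (Fin q) (Fin p) ℂ, IsMoorePenrose (Qᴴ * Y) B' →
      R₂₂ * B = Qpᴴ * Y * B') ∧
    (Y.rank = q → (Xᴴ * Y).rank = q →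
      ∀ Y₀ : Matrix (Fin n) (Fin q) ℂ, Y₀ᴴ * Y₀ = 1 →
        LinearMap.range Y₀.mulVecLin = LinearMap.range Y.mulVecLin →
        ∀ t : ℝ, 0 < t →
          Module.finrank ℂ
              (LinearMap.ker
                ((R₂₂ * B)ᴴ * (R₂₂ * B) - ((t : ℂ) ^ 2) • 1).mulVecLin)
            = Module.finrank ℂ
                (LinearMap.ker
                  ((Qᴴ * Y₀)ᴴ * (Qᴴ * Y₀) - (1 + (t : ℂ) ^ 2)⁻¹ • 1).mulVecLin)) := by
  have hQQp' : Qpᴴ * Q = 0 := by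
    have := congrArg Matrix.conjTranspose hQQp
    simpa using this
  have h1 : R₁₂ = Qᴴ * Y := by
    rw [hY, Matrix.mul_add, ← Matrix.mul_assoc, ← Matrix.mul_assoc, hQ, hQQp]; simp
  have h2 : R₂₂ = Qpᴴ * Y := by
    rw [hY, Matrix.mul_add, ← Matrix.mul_assoc, ← Matrix.mul_assoc, hQp, hQQp']; simp
  have h3 : (Qᴴ * Y).rank = (Xᴴ * Y).rank := by
    have hdet : IsUnit (R₁₁ᴴ).det := by
      rw [Matrix.det_conjTranspose]
      exact ((Matrix.isUnit_iff_isUnit_det _).mp hR₁₁).star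
    rw [hX, Matrix.conjTranspose_mul, Matrix.mul_assoc,
      Matrix.rank_mul_eq_right_of_isUnit_det _ _ hdet]
  refine ⟨h1, h2, h3, ?_, ?_⟩
  · intro B' hB'
    rw [← h1] at hB'
    rw [← h2, mp_unique hB hB']
  · intro _ hr Y₀ hY₀ hrange t ht
    rw [← h3, ← h1] at hr
    have hinj : Function.Injective R₁₂.mulVecLin := by
      rw [← LinearMap.ker_eq_bot, ← Submodule.finrank_eq_zero (R := ℂ)]
      have := LinearMap.finrank_range_add_finrank_ker R₁₂.mulVecLin
      rw [Matrix.rank] at hr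
      simp only [Module.finrank_fin_fun] at this
      omega
    have hBA : B * R₁₂ = 1 := by
      apply Matrix.ext_of_mulVec_single
      intro i
      apply hinj
      simp only [Matrix.mulVecLin_apply, Matrix.mulVec_mulVec]
      rw [← Matrix.mul_assoc, hB.1, Matrix.mul_one]
    obtain ⟨T, hT⟩ := factor_of_range hrange.le
    obtain ⟨S, hS⟩ := factor_of_range hrange.ge
    have hST : S * T = 1 := by
      calc S * T = (Y₀ᴴ * Y₀) * S * T := by rw [hY₀, Matrix.one_mul]
        _ = Y₀ᴴ * (Y₀ * S * T) := by simp only [Matrix.mul_assoc]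
        _ = 1 := by rw [← hS, ← hT, hY₀]
    have hTS : T * S = 1 := mul_eq_one_comm.mp hST
    have hYY : Yᴴ * Y = R₁₂ᴴ * R₁₂ + R₂₂ᴴ * R₂₂ := by
      calc Yᴴ * Y = Yᴴ * ((Q * Qᴴ + Qp * Qpᴴ) * Y) := by rw [hunit, Matrix.one_mul]
        _ = _ := by
          rw [h1, h2]
          simp only [Matrix.conjTranspose_mul, Matrix.conjTranspose_conjTranspose,
            Matrix.add_mul, Matrix.mul_add, Matrix.mul_assoc]
    have hN : Tᴴ * (R₁₂ᴴ * R₁₂ + R₂₂ᴴ * R₂₂) * T = 1 := by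
      rw [← hYY, ← hY₀, hT, Matrix.conjTranspose_mul]
      simp only [Matrix.mul_assoc]
    have hQY : Qᴴ * Y₀ = R₁₂ * T := by rw [hT, h1, Matrix.mul_assoc]
    rw [hQY]
    exact kernel_dims R₁₂ R₂₂ B hB hBA T S hTS hN t ht
end

section
/- Let [X X⊥] ∈ ℂ^{n×n} and [Y Y⊥] ∈ ℂ^{n×n} be unitary matrices with X ∈ ℂ^{n×p} and Y ∈ ℂ^{n×q}. Let B₁ be the Moore–Penrose pseudoinverse of XᴴY and B₂ the Moore–Penrose pseudoinverse of Y⊥ᴴX⊥. Then X⊥ᴴ Y B₁ = − B₂ (Y⊥ᴴ X), i.e., X⊥ᴴY(XᴴY)† = −(Y⊥ᴴX⊥)† Y⊥ᴴX. -/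
open scoped Matrix

theorem sign_aux {a b c d : ℕ} (A : Matrix (Fin a) (Fin b) ℂ) (C : Matrix (Fin c) (Fin b) ℂ)
    (D : Matrix (Fin d) (Fin c) ℂ) (E : Matrix (Fin d) (Fin a) ℂ)
    (B₁ : Matrix (Fin b) (Fin a) ℂ) (hB₁ : IsMoorePenrose A B₁)
    (B₂ : Matrix (Fin c) (Fin d) ℂ) (hB₂ : IsMoorePenrose D B₂)
    (h1 : E * A = -(D * C)) (h2 : C * Aᴴ = -(Dᴴ * E)) :
    C * B₁ = -(B₂ * E) := by
  obtain ⟨a1, a2, a3, a4⟩ := hB₁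
  obtain ⟨d1, d2, d3, d4⟩ := hB₂
  have eB1 : B₁ = Aᴴ * (B₁ᴴ * B₁) := by
    rw [← Matrix.mul_assoc, ← Matrix.conjTranspose_mul, a4, a2]
  have eB2 : B₂ = B₂ * B₂ᴴ * Dᴴ := by
    rw [Matrix.mul_assoc, ← Matrix.conjTranspose_mul, d3, ← Matrix.mul_assoc, d2]
  have eD : B₂ * D * Dᴴ = Dᴴ := by
    rw [← d4, ← Matrix.conjTranspose_mul, ← Matrix.mul_assoc, d1]
  have eA : Aᴴ * (A * B₁) = Aᴴ := by
    rw [← a3, ← Matrix.conjTranspose_mul, a1]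
  have k1 : B₂ * D * (C * B₁) = C * B₁ := by
    have : C * B₁ = -(Dᴴ * (E * (B₁ᴴ * B₁))) := by
      calc C * B₁ = C * (Aᴴ * (B₁ᴴ * B₁)) := by rw [← eB1]
        _ = _ := by rw [← Matrix.mul_assoc, h2, Matrix.neg_mul, Matrix.mul_assoc]
    rw [this, Matrix.mul_neg, ← Matrix.mul_assoc, eD]
  have h3 : Dᴴ * E = -(C * Aᴴ) := by rw [h2, neg_neg]
  have k2 : B₂ * E * (A * B₁) = B₂ * E := by
    have : B₂ * E = -(B₂ * B₂ᴴ * C * Aᴴ) := by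
      calc B₂ * E = B₂ * B₂ᴴ * Dᴴ * E := by rw [← eB2]
        _ = _ := by rw [Matrix.mul_assoc, h3, Matrix.mul_neg, ← Matrix.mul_assoc]
    rw [this, Matrix.neg_mul, Matrix.mul_assoc _ Aᴴ, eA]
  calc C * B₁ = B₂ * (D * C) * B₁ := by rw [← k1]; simp only [Matrix.mul_assoc]
    _ = -(B₂ * (E * A) * B₁) := by rw [h1]; simp
    _ = -(B₂ * E * (A * B₁)) := by simp only [Matrix.mul_assoc]
    _ = _ := by rw [k2]

theorem sign_relation
    (n p q : ℕ)
    (X : Matrix (Fin n) (Fin p) ℂ) (Xp : Matrix (Fin n) (Fin (n - p)) ℂ)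
    (hX : Xᴴ * X = 1) (hXp : Xpᴴ * Xp = 1) (hXXp : Xᴴ * Xp = 0)
    (hXunit : X * Xᴴ + Xp * Xpᴴ = 1)
    (Y : Matrix (Fin n) (Fin q) ℂ) (Yp : Matrix (Fin n) (Fin (n - q)) ℂ)
    (hY : Yᴴ * Y = 1) (hYp : Ypᴴ * Yp = 1) (hYYp : Yᴴ * Yp = 0)
    (hYunit : Y * Yᴴ + Yp * Ypᴴ = 1)
    (B₁ : Matrix (Fin q) (Fin p) ℂ) (hB₁ : IsMoorePenrose (Xᴴ * Y) B₁)
    (B₂ : Matrix (Fin (n - p)) (Fin (n - q)) ℂ) (hB₂ : IsMoorePenrose (Ypᴴ * Xp) B₂) :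
    Xpᴴ * Y * B₁ = -(B₂ * (Ypᴴ * X)) := by
  have hYY' : Ypᴴ * Y = 0 := by
    have := congrArg Matrix.conjTranspose hYYp
    simpa using this
  have hXX' : Xpᴴ * X = 0 := by
    have := congrArg Matrix.conjTranspose hXXp
    simpa using this
  refine sign_aux (Xᴴ * Y) (Xpᴴ * Y) (Ypᴴ * Xp) (Ypᴴ * X) B₁ hB₁ B₂ hB₂ ?_ ?_
  · rw [eq_neg_iff_add_eq_zero]
    calc _ = Ypᴴ * (X * Xᴴ + Xp * Xpᴴ) * Y := by
          simp only [Matrix.mul_add, Matrix.add_mul, Matrix.mul_assoc]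
      _ = 0 := by rw [hXunit, Matrix.mul_one, hYY']
  · rw [eq_neg_iff_add_eq_zero]
    calc _ = Xpᴴ * (Y * Yᴴ + Yp * Ypᴴ) * X := by
          simp only [Matrix.mul_add, Matrix.add_mul, Matrix.mul_assoc, Matrix.conjTranspose_mul,
            Matrix.conjTranspose_conjTranspose]
      _ = 0 := by rw [hYunit, Matrix.mul_one, hXX']
end

section
/- Let X ∈ ℂ^{n×p} and Y ∈ ℂ^{n×q} have orthonormal columns (XᴴX = I and YᴴY = I), so that P_X = XXᴴ and P_Y = YYᴴ are the orthogonal projectors onto the column spaces of X and Y. If B is the Moore–Penrose pseudoinverse of XᴴY, then the matrix Y B Xᴴ is the Moore–Penrose pseudoinverse of P_X P_Y = XXᴴYYᴴ; that is, Y B Xᴴ satisfies the four Penrose equations with respect to XXᴴYYᴴ. -/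
open scoped Matrix

theorem pseudoinverse_of_projector_product
    (n p q : ℕ)
    (X : Matrix (Fin n) (Fin p) ℂ) (hX : Xᴴ * X = 1)
    (Y : Matrix (Fin n) (Fin q) ℂ) (hY : Yᴴ * Y = 1)
    (B : Matrix (Fin q) (Fin p) ℂ) (hB : IsMoorePenrose (Xᴴ * Y) B) :
    IsMoorePenrose (X * Xᴴ * Y * Yᴴ) (Y * B * Xᴴ) := by
  obtain ⟨h1, h2, h3, h4⟩ := hB
  set A := Xᴴ * Y with hA
  have e0 : X * Xᴴ * Y * Yᴴ = X * A * Yᴴ := by simp only [hA, Matrix.mul_assoc]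
  have e1 : (X * A * Yᴴ) * (Y * B * Xᴴ) = X * (A * B) * Xᴴ := by
    calc _ = X * A * (Yᴴ * Y) * B * Xᴴ := by simp only [Matrix.mul_assoc]
      _ = _ := by rw [hY, Matrix.mul_one]; simp only [Matrix.mul_assoc]
  have e2 : (Y * B * Xᴴ) * (X * A * Yᴴ) = Y * (B * A) * Yᴴ := by
    calc _ = Y * B * (Xᴴ * X) * A * Yᴴ := by simp only [Matrix.mul_assoc]
      _ = _ := by rw [hX, Matrix.mul_one]; simp only [Matrix.mul_assoc]
  rw [e0]
  refine ⟨?_, ?_, ?_, ?_⟩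
  · rw [e1]
    calc _ = X * (A * B) * (Xᴴ * X) * A * Yᴴ := by simp only [Matrix.mul_assoc]
      _ = X * (A * B * A) * Yᴴ := by rw [hX, Matrix.mul_one]; simp only [Matrix.mul_assoc]
      _ = _ := by rw [h1]
  · rw [e2]
    calc _ = Y * (B * A) * (Yᴴ * Y) * B * Xᴴ := by simp only [Matrix.mul_assoc]
      _ = Y * (B * A * B) * Xᴴ := by rw [hY, Matrix.mul_one]; simp only [Matrix.mul_assoc]
      _ = _ := by rw [h2]
  · rw [e1, Matrix.conjTranspose_mul, Matrix.conjTranspose_mul, h3,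
      Matrix.conjTranspose_conjTranspose]; simp only [Matrix.mul_assoc]
  · rw [e2, Matrix.conjTranspose_mul, Matrix.conjTranspose_mul, h4,
      Matrix.conjTranspose_conjTranspose]; simp only [Matrix.mul_assoc]
end
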